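/- Let 2 ≤ k ≤ 6 and let q be a power of 3. Then the links of all vertices of the 3-partite 3-uniform hypergraph D_3(k,q) are pairwise isomorphic; indeed, the link of every vertex of D_3(k,q) is isomorphic to the bipartite graph D(k,q). -/

import Mathlib

open scoped Classical

namespace Paper

/-- `G` contains a copy of `F` (an injective graph homomorphism of `F` into `G`). -/
def HasGraphCopy {α β : Type*} (F : SimpleGraph α) (G : SimpleGraph β) : Prop :=
  ∃ f : α ↪ β, ∀ u v, F.Adj u v → G.Adj (f u) (f v)

/-- The 3-uniform hypergraph `H` contains a copy of the 3-uniform hypergraph `F`. -/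
def HasHypCopy {α β : Type*} (F : Set (Finset α)) (H : Set (Finset β)) : Prop :=
  ∃ f : α ↪ β, ∀ e ∈ F, e.map f ∈ H

/-- The suspension `Ĝ` of a graph `G`: a new vertex (`none`) joined to all vertices of `G`. -/
def suspension {α : Type*} (G : SimpleGraph α) : SimpleGraph (Option α) :=
  SimpleGraph.fromRel (fun x y => x = none ∨ ∃ u v, x = some u ∧ y = some v ∧ G.Adj u v)

/-- The hypergraph suspension `G̃` of a graph `G`: the triples `{x, u, v}` over edges `uv` of `G`,
where `x = none` is a new vertex. -/
def hypSuspension {α : Type*} (G : SimpleGraph α) : Set (Finset (Option α)) :=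
  {e | ∃ u v, G.Adj u v ∧ e = {none, some u, some v}}

/-- `ex(n, K₃, F)`: the maximum number of triangles in an `F`-free graph on `n` vertices. -/
noncomputable def exTriangles {α : Type*} (n : ℕ) (F : SimpleGraph α) : ℕ :=
  sSup {t | ∃ G : SimpleGraph (Fin n),
    ¬ HasGraphCopy F G ∧ t = {s : Finset (Fin n) | G.IsNClique 3 s}.ncard}

/-- `ex₃(n, F)`: the maximum number of triples in an `F`-free 3-uniform hypergraph on `n`
vertices. -/
noncomputable def ex3 {α : Type*} (n : ℕ) (F : Set (Finset α)) : ℕ :=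
  sSup {t | ∃ H : Finset (Finset (Fin n)), (∀ e ∈ H, e.card = 3) ∧
    ¬ HasHypCopy F (↑H : Set (Finset (Fin n))) ∧ t = H.card}

/-- `ex(n, C_m)`: the maximum number of edges in a graph on `n` vertices with no cycle of
length `m`. -/
noncomputable def exCycle (n m : ℕ) : ℕ :=
  sSup {t | ∃ G : SimpleGraph (Fin n),
    ¬ HasGraphCopy (SimpleGraph.cycleGraph m) G ∧ t = G.edgeSet.ncard}

/-- The link of a vertex `x` in a 3-uniform hypergraph `H`: `u ~ v` iff `{x, u, v} ∈ H`. -/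
def linkGraph {V : Type*} (H : Set (Finset V)) (x : V) : SimpleGraph V :=
  SimpleGraph.fromRel (fun u v => u ≠ x ∧ v ≠ x ∧ ({x, u, v} : Finset V) ∈ H)

/-!  Coordinates of a vector are labelled `x_1, x_{11}, x_{12}, x_{21}, x_{22}, x'_{22}, x_{23},
x_{32}, x_{33}, x'_{33}, x_{34}, x_{43}, …` and indexed `0, 1, 2, …`.  The `j`-th defining
equation (`j ≥ 1`) of the graph `D(q)` has the form `a_j + b_j + a_{aIdx j} * b_{bIdx j} = 0`. -/

/-- Index of the `a`-coordinate in the product term of the `j`-th equation. -/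
def aIdx : ℕ → ℕ
  | 1 => 0
  | 2 => 0
  | 3 => 1
  | j => if j % 4 = 0 ∨ j % 4 = 3 then j - 2 else 0

/-- Index of the `b`-coordinate in the product term of the `j`-th equation. -/
def bIdx : ℕ → ℕ
  | 1 => 0
  | 2 => 1
  | 3 => 0
  | j => if j % 4 = 0 ∨ j % 4 = 3 then 0 else j - 2

/-- Index of the extra linear term in the `j`-th equation of `D'(q)` (for `j ≥ 2`). -/
def linIdx : ℕ → ℕ
  | 2 => 1
  | j => j - 2

/-- Extend a vector in `F^k` to an `ℕ`-indexed sequence by zeros. -/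
def ext {k : ℕ} {F : Type*} [Zero F] (a : Fin k → F) (j : ℕ) : F :=
  if h : j < k then a ⟨j, h⟩ else 0

/-- The defining relation of the 3-graph `D₃(k,q)`: the first `k-1` equations. -/
def D3rel (k : ℕ) (F : Type*) [CommRing F] (a b c : Fin k → F) : Prop :=
  ∀ j : ℕ, 1 ≤ j → j < k →
    ext a j + ext b j + ext c j
      + ext a (aIdx j) * ext b (bIdx j)
      + ext b (aIdx j) * ext c (bIdx j)
      + ext c (aIdx j) * ext a (bIdx j) = 0

/-- The defining relation of the bipartite graph `D(k,q)`: the first `k-1` equations. -/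
def Drel (k : ℕ) (F : Type*) [CommRing F] (a b : Fin k → F) : Prop :=
  ∀ j : ℕ, 1 ≤ j → j < k →
    ext a j + ext b j + ext a (aIdx j) * ext b (bIdx j) = 0

/-- The defining relation of the bipartite graph `D'(k,q)`: the first `k-1` equations. -/
def D'rel (k : ℕ) (F : Type*) [CommRing F] (a b : Fin k → F) : Prop :=
  ∀ j : ℕ, 1 ≤ j → j < k →
    if j = 1 then
      ext a 1 - ext a 0 + ext b 1 - ext b 0 + ext a 0 * ext b 0 = 0
    else
      ext a j + ext a (linIdx j) + ext b j + ext b (linIdx j)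
        + ext a (aIdx j) * ext b (bIdx j) = 0

/-- The bipartite graph `D(k,q)` on two copies of `F^k`. -/
def DGraph (k : ℕ) (F : Type*) [CommRing F] :
    SimpleGraph ((Fin k → F) ⊕ (Fin k → F)) :=
  SimpleGraph.fromRel (fun x y => ∃ a b, x = Sum.inl a ∧ y = Sum.inr b ∧ Drel k F a b)

/-- The bipartite graph `D'(k,q)` on two copies of `F^k`. -/
def D'Graph (k : ℕ) (F : Type*) [CommRing F] :
    SimpleGraph ((Fin k → F) ⊕ (Fin k → F)) :=
  SimpleGraph.fromRel (fun x y => ∃ a b, x = Sum.inl a ∧ y = Sum.inr b ∧ D'rel k F a b)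

/-- `{a,b,c}`-membership for the link of a vertex `v` lying in part `p` of `D₃(k,q)`:
for `p = 0` (part `A`) the two remaining parts are `B, C`; for `p = 1` (part `B`) they are
`C, A`; for `p = 2` (part `C`) they are `A, B`. -/
def D3edgeProp (k : ℕ) (F : Type*) [CommRing F] (p : Fin 3) (v u w : Fin k → F) : Prop :=
  if p = 0 then D3rel k F v u w
  else if p = 1 then D3rel k F w v u
  else D3rel k F u w v

/-- The link of the vertex `v` in part `p` of the 3-partite 3-graph `D₃(k,q)`, as a bipartite
graph on the two remaining parts. -/
def linkD3 (k : ℕ) (F : Type*) [CommRing F] (p : Fin 3) (v : Fin k → F) :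
    SimpleGraph ((Fin k → F) ⊕ (Fin k → F)) :=
  SimpleGraph.fromRel
    (fun x y => ∃ u w, x = Sum.inl u ∧ y = Sum.inr w ∧ D3edgeProp k F p v u w)


/-- The lower-order part of the change of variables on the first side of the link of `v`. -/
def linkShearLeft {F : Type*} [CommRing F] (v : ℕ → F) : ℕ → (ℕ → F) → F
  | 0, _ => v 0
  | 1, _ => v 1 - v 0 ^ 2
  | 2, b => v 0 * b 1 + v 2
  | 3, b => v 1 * b 0 - v 0 * b 1 + v 3
  | 4, b => v 4 + v 2 * b 0 + v 0 * (v 3 + b 3 + v 1 * b 0) - v 0 * b 2 - v 0 ^ 2 * b 1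
      - v 2 * v 0
  | 5, b => v 5 + v 0 * b 3 + v 0 * (v 2 + b 2 + v 0 * b 1)
      - (v 1 - v 0 ^ 2) * (b 1 + v 1)
  | _, _ => 0

/-- The lower-order part of the change of variables on the second side of the link of `v`. -/
def linkShearRight {F : Type*} [CommRing F] (v : ℕ → F) : ℕ → (ℕ → F) → F
  | 0, _ => v 0
  | 1, _ => 0
  | 2, c => v 1 * c 0 - v 0 * c 1
  | 3, c => v 0 * c 1 - (v 1 - v 0 ^ 2) * (c 0 + v 0)
  | 4, c => v 0 * c 2 + v 0 * c 3 + v 0 ^ 2 * c 1 - v 2 * c 0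
  | 5, c => v 3 * c 0 + v 0 * (c 2 + v 1 * c 0) - (v 1 - v 0 ^ 2) * (c 1 + v 0 * c 0)
      - v 0 * (c 3 + v 0 * c 1 - (v 1 - v 0 ^ 2) * (c 0 + v 0))
  | _, _ => 0

/-- A rule `g` is strictly triangular if its `j`-th value only depends on the entries below `j`. -/
def StrictlyTriangular {F : Type*} (g : ℕ → (ℕ → F) → F) : Prop :=
  ∀ (j : ℕ) (s t : ℕ → F), (∀ i < j, s i = t i) → g j s = g j t

theorem strictlyTriangular_linkShearLeft {F : Type*} [CommRing F] (v : ℕ → F) :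
    StrictlyTriangular (linkShearLeft v) := by
  intro j s t h
  rcases j with _ | _ | _ | _ | _ | _ | j <;> simp [linkShearLeft, h]

theorem strictlyTriangular_linkShearRight {F : Type*} [CommRing F] (v : ℕ → F) :
    StrictlyTriangular (linkShearRight v) := by
  intro j s t h
  rcases j with _ | _ | _ | _ | _ | _ | j <;> simp [linkShearRight, h]

/-- The map `b ↦ b + g(b)` on `F^k`. -/
def shear {F : Type*} [AddZeroClass F] (k : ℕ) (g : ℕ → (ℕ → F) → F) (b : Fin k → F) : Fin k → F :=
  fun j => b j + g j (ext b)

theorem ext_of_lt {k : ℕ} {F : Type*} [Zero F] (a : Fin k → F) {j : ℕ} (hj : j < k) :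
    ext a j = a ⟨j, hj⟩ :=
  dif_pos hj

theorem ext_shear {F : Type*} [AddZeroClass F] {k : ℕ} (g : ℕ → (ℕ → F) → F) (b : Fin k → F)
    {j : ℕ} (hj : j < k) : ext (shear k g b) j = ext b j + g j (ext b) := by
  rw [ext_of_lt _ hj, ext_of_lt _ hj, shear]

theorem StrictlyTriangular.shear_injective {F : Type*} [AddGroup F] {k : ℕ}
    {g : ℕ → (ℕ → F) → F} (hg : StrictlyTriangular g) : Function.Injective (shear k g) := by
  intro b b' h
  have key : ∀ j, j < k → ext b j = ext b' j := by
    intro j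
    induction j using Nat.strong_induction_on with
    | _ j ih =>
      intro hj
      have hj' : ext (shear k g b) j = ext (shear k g b') j := by rw [h]
      rw [ext_shear g b hj, ext_shear g b' hj,
        hg j (ext b) (ext b') fun i hi => ih i hi (hi.trans hj)] at hj'
      exact add_right_cancel hj'
  funext j
  simpa [ext_of_lt _ j.isLt] using key j j.isLt

/-- A strictly triangular rule yields a permutation of `F^k`. -/
noncomputable def StrictlyTriangular.shearEquiv {F : Type*} [AddGroup F] [Finite F] (k : ℕ)
    {g : ℕ → (ℕ → F) → F} (hg : StrictlyTriangular g) : (Fin k → F) ≃ (Fin k → F) :=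
  Equiv.ofBijective (shear k g) (Finite.injective_iff_bijective.mp hg.shear_injective)

theorem D3rel_rotate {k : ℕ} {F : Type*} [CommRing F] (a b c : Fin k → F) :
    D3rel k F a b c ↔ D3rel k F b c a := by
  refine forall_congr' fun j => imp_congr_right fun _ => imp_congr_right fun _ => ?_
  constructor <;> intro h <;> linear_combination h

theorem D3edgeProp_iff {k : ℕ} {F : Type*} [CommRing F] (p : Fin 3) (v u w : Fin k → F) :
    D3edgeProp k F p v u w ↔ D3rel k F v u w := by
  fin_cases p
  · simp [D3edgeProp]
  · simpa [D3edgeProp] using D3rel_rotate w v u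
  · simpa [D3edgeProp] using (D3rel_rotate v u w).symm

/-- The left side of the `j`-th equation of `D(k,q)`. -/
def Deqn {F : Type*} [CommRing F] (b c : ℕ → F) (j : ℕ) : F :=
  b j + c j + b (aIdx j) * c (bIdx j)

/-- The left side of the `j`-th equation of `D₃(k,q)`. -/
def D3eqn {F : Type*} [CommRing F] (a b c : ℕ → F) (j : ℕ) : F :=
  a j + b j + c j + a (aIdx j) * b (bIdx j) + b (aIdx j) * c (bIdx j) + c (aIdx j) * a (bIdx j)

/-- The combination of earlier equations of `D₃(k,q)` that is added to the `j`-th one by the change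
of variables. -/
def linkCorrection {F : Type*} [CommRing F] (v : ℕ → F) : ℕ → (ℕ → F) → F
  | 4, e => v 0 * e 3
  | 5, e => v 0 * e 2 - (v 1 - v 0 ^ 2) * e 1
  | _, _ => 0

theorem linkCorrection_eq_zero {F : Type*} [CommRing F] (v e : ℕ → F) {j : ℕ}
    (he : ∀ i, 1 ≤ i → i < j → e i = 0) : linkCorrection v j e = 0 := by
  unfold linkCorrection
  split
  · simp [he 3]
  · simp [he 2, he 1]
  · rfl

theorem aIdx_lt {j : ℕ} (hj : 1 ≤ j) : aIdx j < j := by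
  unfold aIdx
  split <;> (try split_ifs) <;> omega

theorem bIdx_lt {j : ℕ} (hj : 1 ≤ j) : bIdx j < j := by
  unfold bIdx
  split <;> (try split_ifs) <;> omega

theorem Deqn_linkShear {F : Type*} [CommRing F] (v b c : ℕ → F) {j : ℕ} (hj1 : 1 ≤ j)
    (hj6 : j < 6) :
    Deqn (fun i => b i + linkShearLeft v i b) (fun i => c i + linkShearRight v i c) j =
      D3eqn v b c j + linkCorrection v j (D3eqn v b c) := by
  interval_cases j <;>
    simp [Deqn, D3eqn, linkCorrection, aIdx, bIdx, linkShearLeft, linkShearRight] <;> ring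

theorem Drel_shear_iff {k : ℕ} (hk : k ≤ 6) {F : Type*} [CommRing F] (v b c : Fin k → F) :
    Drel k F (shear k (linkShearLeft (ext v)) b) (shear k (linkShearRight (ext v)) c) ↔
      D3rel k F v b c := by
  have key : ∀ j, 1 ≤ j → j < k →
      Deqn (ext (shear k (linkShearLeft (ext v)) b)) (ext (shear k (linkShearRight (ext v)) c)) j =
        D3eqn (ext v) (ext b) (ext c) j
          + linkCorrection (ext v) j (D3eqn (ext v) (ext b) (ext c)) := by
    intro j hj1 hjk
    rw [← Deqn_linkShear _ _ _ hj1 (hjk.trans_le hk)]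
    simp only [Deqn, ext_shear _ _ hjk, ext_shear _ _ ((aIdx_lt hj1).trans hjk),
      ext_shear _ _ ((bIdx_lt hj1).trans hjk)]
  change (∀ j, 1 ≤ j → j < k → Deqn _ _ j = 0) ↔ ∀ j, 1 ≤ j → j < k → D3eqn _ _ _ j = 0
  constructor
  · intro h j
    induction j using Nat.strong_induction_on with
    | _ j ih =>
      intro hj1 hjk
      have hj := key j hj1 hjk
      rwa [h j hj1 hjk, linkCorrection_eq_zero _ _ fun i hi1 hij => ih i hij hi1 (hij.trans hjk),
        add_zero, eq_comm] at hj
  · intro h j hj1 hjk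
    rw [key j hj1 hjk, h j hj1 hjk,
      linkCorrection_eq_zero _ _ fun i hi1 hij => h i hi1 (hij.trans hjk), add_zero]

/-- The link of any vertex of `D₃(k,q)` with `k ≤ 6` is isomorphic to `D(k,q)`. -/
theorem nonempty_linkD3_iso_DGraph {k : ℕ} (hk : k ≤ 6) (F : Type*) [CommRing F] [Finite F]
    (p : Fin 3) (v : Fin k → F) : Nonempty (linkD3 k F p v ≃g DGraph k F) := by
  refine ⟨⟨Equiv.sumCongr ((strictlyTriangular_linkShearLeft (ext v)).shearEquiv k)
    ((strictlyTriangular_linkShearRight (ext v)).shearEquiv k), ?_⟩⟩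
  rintro (x | x) (y | y) <;>
    simp [linkD3, DGraph, D3edgeProp_iff, StrictlyTriangular.shearEquiv, Drel_shear_iff hk]

/-- For `2 ≤ k ≤ 6` and `q` a power of `3`, the links of all vertices of
`D₃(k,q)` are pairwise isomorphic, and each is isomorphic to the bipartite graph `D(k,q)`. -/
theorem D3_links_isomorphic (k : ℕ) (hk2 : 2 ≤ k) (hk6 : k ≤ 6)
    (F : Type) [Field F] [Fintype F]
    (m : ℕ) (hm : 0 < m) (hcard : Fintype.card F = 3 ^ m) :
    (∀ (p p' : Fin 3) (v v' : Fin k → F),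
      Nonempty (linkD3 k F p v ≃g linkD3 k F p' v')) ∧
    (∀ (p : Fin 3) (v : Fin k → F), Nonempty (linkD3 k F p v ≃g DGraph k F)) :=
  ⟨fun p p' v v' =>
    (nonempty_linkD3_iso_DGraph hk6 F p v).map2 (fun e e' => e.trans e'.symm)
      (nonempty_linkD3_iso_DGraph hk6 F p' v'),
    nonempty_linkD3_iso_DGraph hk6 F⟩

end Paper
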